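/- Let m, u be positive integers, let V be a nonempty set of vectors in ℝ^{m+u}, and let p ∈ [0, 1/2]. Let f, g : ℝ → ℝ be functions such that for every coordinate 1 ≤ i ≤ m+u and all v, v' ∈ V, |f(v_i) − f(v'_i)| ≤ |g(v_i) − g(v'_i)|. Let σ = (σ_1, …, σ_{m+u}) be i.i.d. random variables each equal to 1 with probability p, −1 with probability p, and 0 with probability 1−2p, and assume the suprema below are finite. Then E_σ[ sup_{v ∈ V} Σ_{i=1}^{m+u} σ_i f(v_i) ] ≤ E_σ[ sup_{v ∈ V} Σ_{i=1}^{m+u} σ_i g(v_i) ]. -/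

import Mathlib

open scoped BigOperators

/-- Value of a transductive Rademacher variable outcome: `0 ↦ 1`, `1 ↦ -1`, `2 ↦ 0`. -/
noncomputable def tSign : Fin 3 → ℝ := ![1, -1, 0]

/-- Probability of a transductive Rademacher variable outcome:
`1` with probability `p`, `-1` with probability `p`, `0` with probability `1 - 2p`. -/
noncomputable def tWeight (p : ℝ) : Fin 3 → ℝ := ![p, p, 1 - 2 * p]

/-- Expectation of `F` applied to a vector of `n` i.i.d. transductive Rademacher
variables with parameter `p`. -/
noncomputable def tExp (n : ℕ) (p : ℝ) (F : (Fin n → ℝ) → ℝ) : ℝ :=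
  ∑ s : Fin n → Fin 3, (∏ i, tWeight p (s i)) * F (fun i => tSign (s i))

/-- Symmetric one-coordinate comparison: if `F` contracts `G`, then replacing `F` by `G` increases
the sum of the suprema of `B + F` and `B - F`. -/
theorem iSup_add_iSup_sub_le {T : Type*} [Nonempty T] (B F G : T → ℝ)
    (h : ∀ t t', |F t - F t'| ≤ |G t - G t'|)
    (hadd : BddAbove (Set.range fun t => B t + G t))
    (hsub : BddAbove (Set.range fun t => B t - G t)) :
    (⨆ t, (B t + F t)) + ⨆ t, (B t - F t) ≤ (⨆ t, (B t + G t)) + ⨆ t, (B t - G t) := by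
  have key : ∀ t t', (B t + F t) + (B t' - F t') ≤
      (⨆ t, (B t + G t)) + ⨆ t, (B t - G t) := by
    intro t t'
    have hF := (le_abs_self _).trans (h t t')
    have h1 := le_ciSup hadd t
    have h2 := le_ciSup hsub t'
    have h3 := le_ciSup hadd t'
    have h4 := le_ciSup hsub t
    rcases abs_cases (G t - G t') with ⟨hG, _⟩ | ⟨hG, _⟩ <;> linarith
  rw [← le_sub_iff_add_le]
  refine ciSup_le fun t => ?_
  rw [le_sub_comm]
  refine ciSup_le fun t' => ?_
  linarith [key t t']

theorem tWeight_nonneg {p : ℝ} (hp : p ∈ Set.Icc (0 : ℝ) (1 / 2)) (k : Fin 3) :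
    0 ≤ tWeight p k := by
  obtain ⟨h0, h1⟩ := hp
  fin_cases k <;> simp [tWeight] <;> linarith

theorem exists_abs_mul_add_le {T : Type*} {A F : T → ℝ} (c : ℝ)
    (hA : ∃ C, ∀ t, |A t| ≤ C) (hF : ∃ C, ∀ t, |F t| ≤ C) :
    ∃ C, ∀ t, |A t + c * F t| ≤ C := by
  obtain ⟨C, hC⟩ := hA
  obtain ⟨D, hD⟩ := hF
  refine ⟨C + |c| * D, fun t => (abs_add_le _ _).trans (add_le_add (hC t) ?_)⟩
  rw [abs_mul]
  exact mul_le_mul_of_nonneg_left (hD t) (abs_nonneg c)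

theorem exists_abs_add_sum_mul_le {T ι : Type*} {A : T → ℝ} {F : ι → T → ℝ} (c : ι → ℝ)
    (s : Finset ι) (hA : ∃ C, ∀ t, |A t| ≤ C) (hF : ∀ i, ∃ C, ∀ t, |F i t| ≤ C) :
    ∃ C, ∀ t, |A t + ∑ i ∈ s, c i * F i t| ≤ C := by
  classical
  induction s using Finset.induction_on with
  | empty => simpa using hA
  | insert i s his ih =>
    simp only [Finset.sum_insert his]
    obtain ⟨C, hC⟩ := exists_abs_mul_add_le (c i) ih (hF i)
    refine ⟨C, fun t => (le_of_eq ?_).trans (hC t)⟩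
    congr 1
    ring

theorem bddAbove_range_of_abs_le {T : Type*} {A : T → ℝ} (hA : ∃ C, ∀ t, |A t| ≤ C) :
    BddAbove (Set.range A) := by
  obtain ⟨C, hC⟩ := hA
  refine ⟨C, ?_⟩
  rintro _ ⟨t, rfl⟩
  exact (le_abs_self _).trans (hC t)

/-- One-coordinate contraction for a transductive Rademacher variable. -/
theorem sum_tWeight_mul_iSup_le {T : Type*} [Nonempty T] {p : ℝ} (hp : 0 ≤ p) (B F G : T → ℝ)
    (h : ∀ t t', |F t - F t'| ≤ |G t - G t'|)
    (hB : ∃ C, ∀ t, |B t| ≤ C) (hG : ∃ C, ∀ t, |G t| ≤ C) :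
    ∑ k, tWeight p k * ⨆ t, (B t + tSign k * F t) ≤
      ∑ k, tWeight p k * ⨆ t, (B t + tSign k * G t) := by
  have hadd := bddAbove_range_of_abs_le (exists_abs_mul_add_le 1 hB hG)
  have hsub := bddAbove_range_of_abs_le (exists_abs_mul_add_le (-1) hB hG)
  simp only [one_mul, neg_one_mul, ← sub_eq_add_neg] at hadd hsub
  have key := mul_le_mul_of_nonneg_left (iSup_add_iSup_sub_le B F G h hadd hsub) hp
  simp only [Fin.sum_univ_three, tWeight, tSign, Matrix.cons_val, one_mul, neg_one_mul, zero_mul,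
    ← sub_eq_add_neg, add_zero]
  linarith

theorem sum_cons_tWeight {T : Type*} (n : ℕ) (p : ℝ) (A : T → ℝ) (F : Fin (n + 1) → T → ℝ) :
    ∑ s : Fin (n + 1) → Fin 3, (∏ i, tWeight p (s i)) * ⨆ t, (A t + ∑ i, tSign (s i) * F i t) =
      ∑ k, tWeight p k * ∑ s : Fin n → Fin 3, (∏ i, tWeight p (s i)) *
        ⨆ t, (A t + tSign k * F 0 t + ∑ i, tSign (s i) * F i.succ t) := by
  rw [← (Fin.consEquiv fun _ : Fin (n + 1) => Fin 3).sum_comp, Fintype.sum_prod_type]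
  simp [Fin.consEquiv, Fin.prod_univ_succ, Fin.sum_univ_succ, Finset.mul_sum, mul_assoc, add_assoc]

/-- Contraction for families of bounded functions, with a bounded offset `A`. -/
theorem sum_prod_tWeight_mul_iSup_le {T : Type*} [Nonempty T] {p : ℝ}
    (hp : p ∈ Set.Icc (0 : ℝ) (1 / 2)) (n : ℕ) (A : T → ℝ) (F G : Fin n → T → ℝ)
    (h : ∀ i t t', |F i t - F i t'| ≤ |G i t - G i t'|)
    (hA : ∃ C, ∀ t, |A t| ≤ C) (hF : ∀ i, ∃ C, ∀ t, |F i t| ≤ C)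
    (hG : ∀ i, ∃ C, ∀ t, |G i t| ≤ C) :
    ∑ s : Fin n → Fin 3, (∏ i, tWeight p (s i)) * ⨆ t, (A t + ∑ i, tSign (s i) * F i t) ≤
      ∑ s : Fin n → Fin 3, (∏ i, tWeight p (s i)) * ⨆ t, (A t + ∑ i, tSign (s i) * G i t) := by
  induction n generalizing A with
  | zero => simp
  | succ n ih =>
    rw [sum_cons_tWeight, sum_cons_tWeight]
    have hrec (k : Fin 3) := mul_le_mul_of_nonneg_left
      (ih (fun t => A t + tSign k * F 0 t) (fun i => F i.succ) (fun i => G i.succ)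
        (fun i => h i.succ) (exists_abs_mul_add_le _ hA (hF 0)) (fun i => hF i.succ)
        (fun i => hG i.succ)) (tWeight_nonneg hp k)
    refine (Finset.sum_le_sum fun k _ => hrec k).trans ?_
    simp only [Finset.mul_sum, mul_left_comm (tWeight p _)]
    rw [Finset.sum_comm, Finset.sum_comm (s := (Finset.univ : Finset (Fin 3)))]
    refine Finset.sum_le_sum fun s _ => ?_
    simp only [← Finset.mul_sum]
    refine mul_le_mul_of_nonneg_left ?_ (Finset.prod_nonneg fun i _ => tWeight_nonneg hp _)
    have hstep := sum_tWeight_mul_iSup_le hp.1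
      (fun t => A t + ∑ i, tSign (s i) * G i.succ t) (F 0) (G 0) (h 0)
      (exists_abs_add_sum_mul_le _ _ hA fun i => hG i.succ) (hG 0)
    simpa only [add_right_comm] using hstep

/-- If all linear combinations of a finite family of functions are bounded above, then each
function of the family is bounded. -/
theorem exists_abs_le_of_bddAbove_sum {T ι : Type*} [Fintype ι] {F : ι → T → ℝ}
    (h : ∀ c : ι → ℝ, BddAbove (Set.range fun t => ∑ i, c i * F i t)) (i : ι) :
    ∃ C, ∀ t, |F i t| ≤ C := by
  classical
  obtain ⟨C, hC⟩ := h (Pi.single i 1)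
  obtain ⟨D, hD⟩ := h (Pi.single i (-1))
  refine ⟨max C D, fun t => abs_le'.2 ⟨?_, ?_⟩⟩
  · simpa [Pi.single_apply] using Or.inl (b := F i t ≤ D) (hC ⟨t, rfl⟩)
  · simpa [Pi.single_apply] using Or.inr (a := -F i t ≤ C) (hD ⟨t, rfl⟩)

/-- **Contraction principle for transductive Rademacher averages.**
If `|f(v_i) - f(v'_i)| ≤ |g(v_i) - g(v'_i)|` for all coordinates `i` and all `v, v' ∈ V`,
then `E_σ[sup_{v ∈ V} Σ_i σ_i f(v_i)] ≤ E_σ[sup_{v ∈ V} Σ_i σ_i g(v_i)]`. -/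
theorem stmt0 (m u : ℕ) (hm : 0 < m) (hu : 0 < u) (p : ℝ) (hp : p ∈ Set.Icc (0 : ℝ) (1 / 2))
    (V : Set (Fin (m + u) → ℝ)) (hV : V.Nonempty) (f g : ℝ → ℝ)
    (hfg : ∀ i : Fin (m + u), ∀ v ∈ V, ∀ v' ∈ V,
      |f (v i) - f (v' i)| ≤ |g (v i) - g (v' i)|)
    (hbf : ∀ σ : Fin (m + u) → ℝ,
      BddAbove (Set.range fun v : V => ∑ i, σ i * f ((v : Fin (m + u) → ℝ) i)))
    (hbg : ∀ σ : Fin (m + u) → ℝ,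
      BddAbove (Set.range fun v : V => ∑ i, σ i * g ((v : Fin (m + u) → ℝ) i))) :
    tExp (m + u) p (fun σ => ⨆ v : V, ∑ i, σ i * f ((v : Fin (m + u) → ℝ) i))
      ≤ tExp (m + u) p (fun σ => ⨆ v : V, ∑ i, σ i * g ((v : Fin (m + u) → ℝ) i)) := by
  have : Nonempty V := hV.to_subtype
  have key := sum_prod_tWeight_mul_iSup_le hp (m + u) (fun _ : V => (0 : ℝ))
    (fun i v => f ((v : Fin (m + u) → ℝ) i)) (fun i v => g ((v : Fin (m + u) → ℝ) i))
    (fun i v v' => hfg i v v.2 v' v'.2) ⟨0, by simp⟩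
    (exists_abs_le_of_bddAbove_sum hbf) (exists_abs_le_of_bddAbove_sum hbg)
  simpa only [tExp, zero_add] using key
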